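/- Let p be an odd prime, d ≥ 4 a divisor of p−1 with d ≡ 1 (mod 3), and m = (p−1)/d. Then the third Viète coefficient a_3 = ∑_{0 ≤ i < j < l ≤ d−1} η_i·η_j·η_l of the period polynomial satisfies a_3 = p·A − (1/3)·C(d−1,2)·m², where A = ∑_{n=1}^{(d−1)/3} ∑_{j=n}^{d−2n−1} z({0, n, n+j}) (the 3-element subsets {0, n, n+j} being taken in ZMod d) and C(d−1,2) = (d−1)(d−2)/2. -/

import Mathlib

/-- The coset `C_s = g^s · C₀` (as a subset of `ZMod p`) of the subgroup `C₀` of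
d-th powers of units, for `s : ZMod d`. -/
def Cset (p d : ℕ) [NeZero p] (g : (ZMod p)ˣ) (s : ZMod d) : Finset (ZMod p) :=
  Finset.univ.filter fun x : ZMod p =>
    ∃ y : (ZMod p)ˣ, x = (g : ZMod p) ^ s.val * (y : ZMod p) ^ d

/-- The Gauss d-period `η_j = ∑_{x ∈ C_j} ζ^x`. -/
noncomputable def eta (p d : ℕ) [NeZero p] (g : (ZMod p)ˣ) (ζ : ℂ) (j : ZMod d) : ℂ :=
  ∑ x ∈ Cset p d g j, ζ ^ x.val

/-- The Gauss symbol `N(S)`. -/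
noncomputable def gaussN (p d : ℕ) [NeZero p] (g : (ZMod p)ˣ) (S : Finset (ZMod d)) : ℕ :=
  Nat.card {f : S → ZMod p //
    (∀ s : S, f s ∈ Cset p d g (s : ZMod d)) ∧ ∑ s : S, f s = 0}

section Cosets

variable {p d m : ℕ} [Fact p.Prime] {g : (ZMod p)ˣ}

lemma orderOf_generator (hg : ∀ x : (ZMod p)ˣ, ∃ n : ℕ, g ^ n = x) : orderOf g = p - 1 := by
  have h : ∀ x, x ∈ Subgroup.zpowers g := fun x => by
    obtain ⟨n, rfl⟩ := hg x
    exact Subgroup.npow_mem_zpowers g n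
  rw [orderOf_eq_card_of_forall_mem_zpowers h, Nat.card_eq_fintype_card, ZMod.card_units]

lemma pow_mem_Cset_iff [NeZero d] (hdvd : d ∣ p - 1)
    (hg : ∀ x : (ZMod p)ˣ, ∃ n : ℕ, g ^ n = x) (k : ℕ) (s : ZMod d) :
    ((g ^ k : (ZMod p)ˣ) : ZMod p) ∈ Cset p d g s ↔ (k : ZMod d) = s := by
  have hs : ((s.val : ℕ) : ZMod d) = s := ZMod.natCast_zmod_val s
  simp only [Cset, Finset.mem_filter, Finset.mem_univ, true_and]
  constructor
  · rintro ⟨y, hy⟩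
    obtain ⟨e, rfl⟩ := hg y
    have h : g ^ k = g ^ (s.val + e * d) := by
      ext
      rw [hy]
      push_cast
      rw [pow_add, pow_mul]
    rw [pow_eq_pow_iff_modEq, orderOf_generator hg] at h
    have := (ZMod.natCast_eq_natCast_iff _ _ _).2 (h.of_dvd hdvd)
    rw [this]
    simp [hs]
  · intro h
    rw [← hs] at h
    have h' : (d : ℤ) ∣ (k : ℤ) - s.val := by
      rw [← ZMod.intCast_zmod_eq_zero_iff_dvd]
      push_cast
      rw [h, sub_self]
    obtain ⟨e, he⟩ := h'
    refine ⟨g ^ e, ?_⟩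
    rw [← Units.val_pow_eq_pow_val, ← Units.val_pow_eq_pow_val, ← Units.val_mul]
    congr 1
    rw [← zpow_natCast, ← zpow_natCast g s.val, ← zpow_natCast (g ^ e), ← zpow_mul, ← zpow_add]
    congr 1
    linarith

lemma exists_pow_of_mem_Cset (hg : ∀ x : (ZMod p)ˣ, ∃ n : ℕ, g ^ n = x) {s : ZMod d} {x : ZMod p}
    (hx : x ∈ Cset p d g s) : ∃ k : ℕ, ((g ^ k : (ZMod p)ˣ) : ZMod p) = x := by
  simp only [Cset, Finset.mem_filter, Finset.mem_univ, true_and] at hx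
  obtain ⟨y, rfl⟩ := hx
  obtain ⟨k, hk⟩ := hg (g ^ s.val * y ^ d)
  exact ⟨k, by rw [hk]; simp⟩

lemma card_Cset [NeZero d] (hdm : p - 1 = d * m)
    (hg : ∀ x : (ZMod p)ˣ, ∃ n : ℕ, g ^ n = x) (s : ZMod d) :
    (Cset p d g s).card = m := by
  have hdvd : d ∣ p - 1 := ⟨m, hdm⟩
  have hd : 0 < d := NeZero.pos d
  have hval : s.val < d := ZMod.val_lt s
  have hlt : ∀ i < m, s.val + d * i < orderOf g := fun i hi => by
    rw [orderOf_generator hg, hdm]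
    calc s.val + d * i < d + d * i := by omega
      _ = d * (i + 1) := by ring
      _ ≤ d * m := Nat.mul_le_mul_left _ hi
  have hm : 0 < d * m := by
    have := (Fact.out : p.Prime).two_le
    omega
  rw [← Finset.card_range m]
  symm
  refine Finset.card_bij (fun i _ => ((g ^ (s.val + d * i) : (ZMod p)ˣ) : ZMod p)) ?_ ?_ ?_
  · intro i _
    rw [pow_mem_Cset_iff hdvd hg]
    simp
  · intro i hi j hj h
    have := pow_injOn_Iio_orderOf (hlt i (Finset.mem_range.1 hi)) (hlt j (Finset.mem_range.1 hj))
      (Units.ext h)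
    simp only [add_right_inj] at this
    exact Nat.eq_of_mul_eq_mul_left hd this
  · intro x hx
    obtain ⟨k, rfl⟩ := exists_pow_of_mem_Cset hg hx
    have hk : ((k % (d * m) : ℕ) : ZMod d) = s := by
      rw [← (pow_mem_Cset_iff hdvd hg k s).1 hx, ZMod.natCast_eq_natCast_iff]
      exact (Nat.mod_modEq k (d * m)).of_dvd (dvd_mul_right d m)
    have hmod : s.val = k % (d * m) % d := by rw [← hk, ZMod.val_natCast]
    refine ⟨k % (d * m) / d, ?_, ?_⟩
    · rw [Finset.mem_range]
      exact Nat.div_lt_of_lt_mul (Nat.mod_lt _ hm)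
    · rw [hmod, Nat.mod_add_div, ← hdm, ← orderOf_generator hg, pow_mod_orderOf]

lemma sum_Cset_add [NeZero d] {M : Type*} [AddCommMonoid M] (hdvd : d ∣ p - 1)
    (hg : ∀ x : (ZMod p)ˣ, ∃ n : ℕ, g ^ n = x) (f : ZMod p → M) (s : ZMod d) (k : ℕ) :
    ∑ x ∈ Cset p d g (s + k), f x = ∑ x ∈ Cset p d g s, f ((g ^ k : (ZMod p)ˣ) * x) := by
  symm
  refine Finset.sum_bij (fun x _ => ((g ^ k : (ZMod p)ˣ) : ZMod p) * x) ?_ ?_ ?_ (fun _ _ => rfl)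
  · intro x hx
    obtain ⟨j, rfl⟩ := exists_pow_of_mem_Cset hg hx
    rw [pow_mem_Cset_iff hdvd hg] at hx
    rw [← Units.val_mul, ← pow_add, pow_mem_Cset_iff hdvd hg, ← hx]
    push_cast
    ring
  · intro x _ y _ h
    exact (Units.mul_right_inj _).1 h
  · intro y hy
    obtain ⟨j, rfl⟩ := exists_pow_of_mem_Cset hg hy
    obtain ⟨i, hi⟩ := hg ((g ^ k)⁻¹ * g ^ j)
    have hij : g ^ k * g ^ i = g ^ j := by rw [hi, mul_inv_cancel_left]
    refine ⟨((g ^ i : (ZMod p)ˣ) : ZMod p), ?_, by rw [← Units.val_mul, hij]⟩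
    rw [← hij, ← pow_add, pow_mem_Cset_iff hdvd hg] at hy
    rw [pow_mem_Cset_iff hdvd hg]
    push_cast at hy
    rw [add_comm] at hy
    exact add_right_cancel hy

end Cosets

section Periods

variable {p d m : ℕ} [Fact p.Prime] {g : (ZMod p)ˣ} {ζ : ℂ}

lemma addChar_map_sum {ι G R : Type*} [AddCommGroup G] [CommRing R] (ψ : AddChar G R)
    (s : Finset ι) (f : ι → G) : ψ (∑ i ∈ s, f i) = ∏ i ∈ s, ψ (f i) := by
  classical
  induction s using Finset.induction_on with
  | empty => simp
  | insert a s ha ih => rw [Finset.sum_insert ha, Finset.prod_insert ha, ψ.map_add_eq_mul, ih]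

lemma sum_units_addChar {ψ : AddChar (ZMod p) ℂ} (hψ : ψ.IsPrimitive) (y : ZMod p) :
    ∑ u : (ZMod p)ˣ, ψ (u * y) = (if y = 0 then (p : ℂ) else 0) - 1 := by
  have h := AddChar.sum_mulShift y hψ
  rw [ZMod.card, ← Finset.add_sum_erase _ _ (Finset.mem_univ (0 : ZMod p)), zero_mul,
    AddChar.map_zero_eq_one] at h
  have h' : ∑ u : (ZMod p)ˣ, ψ (u * y) = ∑ x ∈ Finset.univ.erase (0 : ZMod p), ψ (x * y) := by
    refine Finset.sum_bij (fun u _ => (u : ZMod p)) ?_ ?_ ?_ (fun _ _ => rfl)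
    · intro u _
      simp
    · intro u _ v _ h
      exact Units.ext h
    · intro x hx
      exact ⟨Units.mk0 x (Finset.ne_of_mem_erase hx), Finset.mem_univ _, rfl⟩
  rw [h', eq_sub_iff_add_eq, add_comm, h]
  push_cast
  rfl

lemma sum_range_mul_natCast {M : Type*} [AddCommMonoid M] (H : ZMod d → M) (m : ℕ) :
    ∑ k ∈ Finset.range (d * m), H k = m • ∑ k ∈ Finset.range d, H k := by
  induction m with
  | zero => simp
  | succ m ih =>
    rw [Nat.mul_succ, Finset.sum_range_add, ih, succ_nsmul]
    simp

/-- Summing a product of periods over all translates of its index set counts the zero-sum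
systems of representatives of the cosets. -/
lemma sum_translates_prod_eta [NeZero d] (hdm : p - 1 = d * m)
    (hg : ∀ x : (ZMod p)ˣ, ∃ n : ℕ, g ^ n = x) (hζ : IsPrimitiveRoot ζ p) (S : Finset (ZMod d)) :
    (m : ℂ) * ∑ t ∈ Finset.range d, ∏ s ∈ S, eta p d g ζ (s + (t : ZMod d)) =
      p * (gaussN p d g S : ℂ) - (m : ℂ) ^ S.card := by
  classical
  have hdvd : d ∣ p - 1 := ⟨m, hdm⟩
  set ψ : AddChar (ZMod p) ℂ := AddChar.zmodChar p hζ.pow_eq_one with hψ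
  have hprim : ψ.IsPrimitive := AddChar.zmodChar_primitive_of_primitive_root p hζ
  have hzp : ∀ x, x ∈ Subgroup.zpowers g := fun x => by
    obtain ⟨n, rfl⟩ := hg x
    exact Subgroup.npow_mem_zpowers g n
  have key : ∑ k ∈ Finset.range (d * m), ∏ s ∈ S, eta p d g ζ (s + (k : ZMod d)) =
      ∑ u : (ZMod p)ˣ, ∏ s : S, ∑ x ∈ Cset p d g s, ψ (u * x) := by
    rw [← IsCyclic.image_range_orderOf hzp, Finset.sum_image, orderOf_generator hg, hdm]
    · refine Finset.sum_congr rfl fun k _ => ?_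
      rw [← Finset.prod_coe_sort]
      refine Finset.prod_congr rfl fun s _ => ?_
      exact sum_Cset_add hdvd hg ψ s k
    · intro i hi j hj h
      exact pow_injOn_Iio_orderOf (by simpa using hi) (by simpa using hj) h
  have hN : (gaussN p d g S : ℂ) =
      ∑ x ∈ Fintype.piFinset fun s : S => Cset p d g s, if ∑ s, x s = 0 then 1 else 0 := by
    rw [← Finset.sum_filter, Finset.sum_const, nsmul_one, gaussN, Nat.subtype_card]
    intro f
    rw [Finset.mem_filter, Fintype.mem_piFinset]
  rw [← nsmul_eq_mul, ← sum_range_mul_natCast (fun k : ZMod d => ∏ s ∈ S, eta p d g ζ (s + k)),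
    key]
  simp_rw [Finset.prod_univ_sum, ← addChar_map_sum, ← Finset.mul_sum]
  rw [Finset.sum_comm]
  simp_rw [sum_units_addChar hprim]
  rw [Finset.sum_sub_distrib, hN, Finset.mul_sum]
  congr 1
  · refine Finset.sum_congr rfl fun x _ => ?_
    rw [mul_ite, mul_one, mul_zero]
  · simp [card_Cset hdm hg]

lemma isIntegral_eta (hζ : IsPrimitiveRoot ζ p) (j : ZMod d) : IsIntegral ℤ (eta p d g ζ j) :=
  IsIntegral.sum _ fun _ _ => (hζ.isIntegral (Fact.out : p.Prime).pos).pow _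

lemma dvd_gaussN [NeZero d] (hdm : p - 1 = d * m)
    (hg : ∀ x : (ZMod p)ˣ, ∃ n : ℕ, g ^ n = x) (hζ : IsPrimitiveRoot ζ p) {S : Finset (ZMod d)}
    (hS : S.Nonempty) : m ∣ gaussN p d g S := by
  have hp : 2 ≤ p := (Fact.out : p.Prime).two_le
  have hm : m ≠ 0 := by
    rintro rfl
    omega
  have hmC : (m : ℂ) ≠ 0 := Nat.cast_ne_zero.2 hm
  have h := sum_translates_prod_eta hdm hg hζ S
  have hint : IsIntegral ℤ (∑ t ∈ Finset.range d, ∏ s ∈ S, eta p d g ζ (s + (t : ZMod d))) :=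
    IsIntegral.sum _ fun _ _ => IsIntegral.prod _ fun _ _ => isIntegral_eta hζ _
  have hq : ∑ t ∈ Finset.range d, ∏ s ∈ S, eta p d g ζ (s + (t : ZMod d)) =
      algebraMap ℚ ℂ ((p * (gaussN p d g S : ℚ) - (m : ℚ) ^ S.card) / m) := by
    simp only [map_div₀, map_sub, map_mul, map_pow, map_natCast]
    rw [eq_div_iff hmC, mul_comm, h]
  rw [hq, isIntegral_algebraMap_iff (algebraMap ℚ ℂ).injective,
    IsIntegrallyClosed.isIntegral_iff] at hint
  obtain ⟨k, hk⟩ := hint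
  rw [eq_div_iff (Nat.cast_ne_zero.2 hm)] at hk
  have hk' : k * m = p * (gaussN p d g S : ℤ) - (m : ℤ) ^ S.card := by
    have : (algebraMap ℤ ℚ k) = (k : ℚ) := rfl
    rw [this] at hk
    exact_mod_cast hk
  have hcop : Nat.Coprime m p := by
    rw [Nat.coprime_comm, (Fact.out : p.Prime).coprime_iff_not_dvd]
    intro hpm
    have h1 := Nat.le_of_dvd (Nat.pos_of_ne_zero hm) hpm
    have h2 : m ≤ d * m := Nat.le_mul_of_pos_left m (NeZero.pos d)
    omega
  refine hcop.dvd_of_dvd_mul_left ?_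
  rw [← Int.natCast_dvd_natCast]
  push_cast
  have : (p : ℤ) * (gaussN p d g S : ℤ) = k * m + (m : ℤ) ^ S.card := by
    rw [hk']
    ring
  rw [this]
  exact dvd_add (dvd_mul_left _ _) (dvd_pow_self _ hS.card_ne_zero)

end Periods

section Triples

/-- A triple `i < j < l < d` is cut out of a cycle of length `d` by its three gaps; when `3 ∤ d`
exactly one rotation puts a smallest gap first and makes the last gap strictly larger. -/
lemma sum_triples_eq_sum_gaps {M : Type*} [AddCommMonoid M] {d : ℕ} (hd3 : d % 3 = 1)
    (F : ZMod d → ZMod d → ZMod d → M) (hF : ∀ a b c, F a b c = F b c a) :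
    ∑ i ∈ Finset.range d, ∑ j ∈ Finset.Ioo i d, ∑ l ∈ Finset.Ioo j d, F i j l =
      ∑ n ∈ Finset.Icc 1 ((d - 1) / 3), ∑ j ∈ Finset.Icc n (d - 2 * n - 1),
        ∑ t ∈ Finset.range d, F t ((n : ZMod d) + t) (((n + j : ℕ) : ZMod d) + t) := by
  have hl : ∑ i ∈ Finset.range d, ∑ j ∈ Finset.Ioo i d, ∑ l ∈ Finset.Ioo j d, F i j l =
      ∑ x ∈ ((Finset.range d) ×ˢ (Finset.range d) ×ˢ (Finset.range d)).filter
        (fun x => x.1 < x.2.1 ∧ x.2.1 < x.2.2), F x.1 x.2.1 x.2.2 := by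
    symm
    rw [Finset.sum_finset_product _ (Finset.range d) fun i =>
      (Finset.Ioo i d ×ˢ Finset.range d).filter fun y => y.1 < y.2]
    · refine Finset.sum_congr rfl fun i _ => Finset.sum_finset_product _ _ _ ?_
      rintro ⟨j, l⟩
      simp only [Finset.mem_filter, Finset.mem_product, Finset.mem_range, Finset.mem_Ioo]
      omega
    · rintro ⟨i, j, l⟩
      simp only [Finset.mem_filter, Finset.mem_product, Finset.mem_range, Finset.mem_Ioo]
      omega
  have hr : ∑ n ∈ Finset.Icc 1 ((d - 1) / 3), ∑ j ∈ Finset.Icc n (d - 2 * n - 1),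
        ∑ t ∈ Finset.range d, F t ((n : ZMod d) + t) (((n + j : ℕ) : ZMod d) + t) =
      ∑ x ∈ ((Finset.range d) ×ˢ (Finset.range d) ×ˢ (Finset.range d)).filter
        (fun x => 1 ≤ x.1 ∧ x.1 ≤ x.2.1 ∧ 2 * x.1 + x.2.1 + 1 ≤ d),
        F x.2.2 ((x.1 : ZMod d) + x.2.2) (((x.1 + x.2.1 : ℕ) : ZMod d) + x.2.2) := by
    symm
    rw [Finset.sum_finset_product _ (Finset.Icc 1 ((d - 1) / 3)) fun n =>
      Finset.Icc n (d - 2 * n - 1) ×ˢ Finset.range d]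
    · refine Finset.sum_congr rfl fun n _ => ?_
      rw [Finset.sum_product]
    · rintro ⟨n, j, t⟩
      simp only [Finset.mem_filter, Finset.mem_product, Finset.mem_range, Finset.mem_Icc]
      omega
  have hwrap : ∀ a b : ℕ, a = b + d → (a : ZMod d) = b := fun a b h => by simp [h]
  rw [hl, hr]
  refine Finset.sum_bij'
    (fun x _ => if x.2.1 - x.1 ≤ x.2.2 - x.2.1 ∧ x.2.1 - x.1 < d - x.2.2 + x.1 then
        (x.2.1 - x.1, x.2.2 - x.2.1, x.1)
      else if x.2.2 - x.2.1 ≤ d - x.2.2 + x.1 ∧ x.2.2 - x.2.1 < x.2.1 - x.1 then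
        (x.2.2 - x.2.1, d - x.2.2 + x.1, x.2.1)
      else (d - x.2.2 + x.1, x.2.1 - x.1, x.2.2))
    (fun x _ => if x.1 + x.2.1 + x.2.2 < d then (x.2.2, x.1 + x.2.2, x.1 + x.2.1 + x.2.2)
      else if x.1 + x.2.2 < d then (x.1 + x.2.1 + x.2.2 - d, x.2.2, x.1 + x.2.2)
      else (x.1 + x.2.2 - d, x.1 + x.2.1 + x.2.2 - d, x.2.2)) ?_ ?_ ?_ ?_ ?_
  · rintro ⟨i, j, l⟩ h
    simp only [Finset.mem_filter, Finset.mem_product, Finset.mem_range] at h ⊢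
    split_ifs <;> dsimp only <;> omega
  · rintro ⟨n, j, t⟩ h
    simp only [Finset.mem_filter, Finset.mem_product, Finset.mem_range] at h ⊢
    split_ifs <;> dsimp only <;> omega
  · rintro ⟨i, j, l⟩ h
    simp only [Finset.mem_filter, Finset.mem_product, Finset.mem_range] at h ⊢
    ext <;> grind
  · rintro ⟨n, j, t⟩ h
    simp only [Finset.mem_filter, Finset.mem_product, Finset.mem_range] at h ⊢
    ext <;> grind
  · rintro ⟨i, j, l⟩ h
    simp only [Finset.mem_filter, Finset.mem_product, Finset.mem_range] at h ⊢
    split_ifs with h1 h2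
    · dsimp only
      rw [← Nat.cast_add, ← Nat.cast_add, show j - i + i = j by omega,
        show j - i + (l - j) + i = l by omega]
    · dsimp only
      rw [← Nat.cast_add, ← Nat.cast_add, show l - j + j = l by omega,
        hwrap (l - j + (d - l + i) + j) i (by omega), hF]
    · dsimp only
      rw [← Nat.cast_add, ← Nat.cast_add, hwrap (d - l + i + l) i (by omega),
        hwrap (d - l + i + (j - i) + l) j (by omega), ← hF]

lemma sum_card_gaps {d : ℕ} (hd3 : d % 3 = 1) :
    ∑ n ∈ Finset.Icc 1 ((d - 1) / 3), ∑ _j ∈ Finset.Icc n (d - 2 * n - 1), (1 : ℂ) =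
      (1 / 3 : ℂ) * ((Nat.choose (d - 1) 2 : ℕ) : ℂ) := by
  obtain ⟨k, rfl⟩ : ∃ k, d = 3 * k + 1 := ⟨d / 3, by omega⟩
  have h : ∀ r ≤ k, ∑ n ∈ Finset.Icc 1 r, ∑ _j ∈ Finset.Icc n (3 * k + 1 - 2 * n - 1), (1 : ℂ) =
      r * (3 * k + 1) - 3 * (r * (r + 1) / 2) := by
    intro r hr
    induction r with
    | zero => simp
    | succ r ih =>
      rw [Finset.sum_Icc_succ_top (by omega), ih (by omega), Finset.sum_const, nsmul_one,
        Nat.card_Icc,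
        show 3 * k + 1 - 2 * (r + 1) - 1 + 1 - (r + 1) = 3 * (k - (r + 1)) + 1 by omega]
      push_cast [Nat.cast_sub hr]
      ring
  rw [show (3 * k + 1 - 1) / 3 = k by omega, h k le_rfl, Nat.add_sub_cancel, Nat.cast_choose_two]
  push_cast
  ring

end Triples

/-- Proposition 14, case d ≡ 1 mod 3: the third Viète coefficient
a₃ = ∑_{0 ≤ i < j < l ≤ d−1} η_i·η_j·η_l satisfies a₃ = p·A − (1/3)·C(d−1,2)·m²,
with A = ∑_{n=1}^{(d−1)/3} ∑_{j=n}^{d−2n−1} z({0, n, n+j}) and z(S) = N(S)/m. -/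
theorem third_viete_coefficient (p d m : ℕ) [Fact p.Prime] [NeZero d]
    (hp : Odd p) (hd4 : 4 ≤ d) (hdvd : d ∣ p - 1) (hd3 : d % 3 = 1)
    (hdm : p - 1 = d * m)
    (g : (ZMod p)ˣ) (hg : ∀ x : (ZMod p)ˣ, ∃ n : ℕ, g ^ n = x)
    (ζ : ℂ) (hζ : IsPrimitiveRoot ζ p)
    (A : ℕ)
    (hA : A = ∑ n ∈ Finset.Icc 1 ((d - 1) / 3), ∑ j ∈ Finset.Icc n (d - 2 * n - 1),
        gaussN p d g ({0, (n : ZMod d), ((n + j : ℕ) : ZMod d)} : Finset (ZMod d)) / m) :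
    (∑ i ∈ Finset.range d, ∑ j ∈ Finset.Ioo i d, ∑ l ∈ Finset.Ioo j d,
        eta p d g ζ (i : ZMod d) * eta p d g ζ (j : ZMod d) * eta p d g ζ (l : ZMod d))
      = (p : ℂ) * (A : ℂ) - (1 / 3 : ℂ) * ((Nat.choose (d - 1) 2 : ℕ) : ℂ) * (m : ℂ) ^ 2 := by
  have hm : (m : ℂ) ≠ 0 := by
    have := (Fact.out : p.Prime).two_le
    rw [Nat.cast_ne_zero]
    rintro rfl
    omega
  rw [sum_triples_eq_sum_gaps hd3 (fun a b c => eta p d g ζ a * eta p d g ζ b * eta p d g ζ c)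
    (fun a b c => by ring), ← sum_card_gaps hd3, hA]
  push_cast
  rw [Finset.mul_sum, Finset.sum_mul, ← Finset.sum_sub_distrib]
  refine Finset.sum_congr rfl fun n hn => ?_
  rw [Finset.mul_sum, Finset.sum_mul, ← Finset.sum_sub_distrib]
  refine Finset.sum_congr rfl fun j hj => ?_
  rw [Finset.mem_Icc] at hn hj
  have hne : ∀ a b : ℕ, a < b → b < d → (a : ZMod d) ≠ b := fun a b hab hb h => by
    rw [ZMod.natCast_eq_natCast_iff', Nat.mod_eq_of_lt (hab.trans hb), Nat.mod_eq_of_lt hb] at h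
    omega
  have h01 : (0 : ZMod d) ≠ (n : ZMod d) := by simpa using hne 0 n (by omega) (by omega)
  have h02 : (0 : ZMod d) ≠ ((n + j : ℕ) : ZMod d) := by
    simpa using hne 0 (n + j) (by omega) (by omega)
  have h12 : (n : ZMod d) ≠ ((n + j : ℕ) : ZMod d) := hne n (n + j) (by omega) (by omega)
  have h := sum_translates_prod_eta hdm hg hζ {0, (n : ZMod d), ((n + j : ℕ) : ZMod d)}
  rw [Finset.card_eq_three.2 ⟨_, _, _, h01, h02, h12, rfl⟩] at h
  have hprod : ∀ t : ℕ, ∏ s ∈ ({0, (n : ZMod d), ((n + j : ℕ) : ZMod d)} : Finset (ZMod d)),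
      eta p d g ζ (s + (t : ZMod d)) = eta p d g ζ t * eta p d g ζ ((n : ZMod d) + t) *
        eta p d g ζ (((n + j : ℕ) : ZMod d) + t) := fun t => by
    rw [Finset.prod_insert (by simp only [Finset.mem_insert, Finset.mem_singleton]; tauto),
      Finset.prod_pair h12, zero_add, mul_assoc]
  simp_rw [hprod] at h
  push_cast at h ⊢
  apply mul_left_cancel₀ hm
  rw [h, ← Nat.cast_add, Nat.cast_div (dvd_gaussN hdm hg hζ (Finset.insert_nonempty _ _)) hm]
  field_simp
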